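/- arXiv:0705.4423 — 2 statements merged into one kernel-verified Lean document; each statement's English description precedes it below -/
import Mathlib

section
/- Let m ≥ 2 and n ≥ 1 be integers, set N = n + 2m − 1, and let a_1, …, a_m be nonzero complex numbers satisfying a_i^N = 1 for all i. For an integer p, write c(p) = (p, m−2, m−3, …, 1, 0) for the exponent vector whose first entry is p and whose remaining entries are m−2, m−3, …, 1, 0. Then the following D_m-alternating sum identities hold: (i) S(c(n+m)) = S(ρ); (ii) S(c(n+m+j−1)) = 0 for every j with 2 ≤ j ≤ m−1; (iii) S(c(n+2m−1)) = 0; (iv) S(c(n+3m−j−1)) = 0 for every j with 2 ≤ j ≤ m−1; (v) S(c(n+3m−2)) = S(ρ). (These state that any g = diag(a_1, a_1^{−1}, …, a_m, a_m^{−1}) ∈ SO(2m) with a_i^{n+2m−1} = 1 satisfies, in Weyl-numerator form, Q¹_{n+1}(g) = 1, Q¹_{n+j}(g) = 0 for j = 2, …, 2m−2, and Q¹_{n+2m−1}(g) = 1.) -/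
/-- The `D_m`-alternating sum `S(c) = Σ_{(σ,ε)∈W(D_m)} sgn(σ) ∏ i, a i ^ (ε i * c (σ i))`,
where `W(D_m)` consists of pairs of a permutation `σ` of `{1,…,m}` and a sign vector
`ε ∈ {±1}^m` with `∏ i, ε i = 1`. -/
noncomputable def DSum (m : ℕ) (a : Fin m → ℂ) (c : Fin m → ℤ) : ℂ :=
  ∑ σ : Equiv.Perm (Fin m),
    ∑ ε ∈ Finset.univ.filter (fun ε : Fin m → ℤˣ => ∏ i, ε i = 1),
      ((Equiv.Perm.sign σ : ℤ) : ℂ) * ∏ i, a i ^ ((ε i : ℤ) * c (σ i))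

/-- The exponent vector `c(p) = (p, m−2, m−3, …, 1, 0)`. -/
def cvecP (m : ℕ) (p : ℤ) : Fin m → ℤ :=
  fun k => if (k : ℕ) = 0 then p else (m : ℤ) - 1 - (k : ℕ)

/-- The Weyl vector exponents `ρ = (m−1, m−2, …, 1, 0)` of `D_m`. -/
def rhoD (m : ℕ) : Fin m → ℤ := fun k => (m : ℤ) - 1 - (k : ℕ)

theorem DSum_congr_mod (m N : ℕ) (a : Fin m → ℂ) (ha : ∀ i, a i ≠ 0)
    (haN : ∀ i, a i ^ N = 1) (c c' : Fin m → ℤ) (h : ∀ k, ∃ t : ℤ, c k = c' k + N * t) :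
    DSum m a c = DSum m a c' := by
  unfold DSum
  refine Finset.sum_congr rfl fun σ _ => Finset.sum_congr rfl fun ε _ => ?_
  congr 1
  refine Finset.prod_congr rfl fun i _ => ?_
  obtain ⟨t, ht⟩ := h (σ i)
  have e : (ε i : ℤ) * c (σ i) = (ε i : ℤ) * c' (σ i) + (N : ℤ) * (t * (ε i : ℤ)) := by
    rw [ht]; ring
  rw [e, zpow_add₀ (ha i), zpow_mul (a i) (N : ℤ), zpow_natCast, haN, one_zpow, mul_one]

theorem DSum_eq_zero (m : ℕ) (a : Fin m → ℂ) (c : Fin m → ℤ) (i j : Fin m) (hij : i ≠ j)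
    (h : c i = c j) : DSum m a c = 0 := by
  have hc : ∀ k, c (Equiv.swap i j k) = c k := by
    intro k
    rw [Equiv.swap_apply_def]
    split_ifs with h1 h2
    · rw [h1, h]
    · rw [h2, h]
    · rfl
  have key : DSum m a c = - DSum m a c := by
    conv_lhs => unfold DSum
    rw [← Equiv.sum_comp (Equiv.mulLeft (Equiv.swap i j))]
    unfold DSum
    rw [← Finset.sum_neg_distrib]
    refine Finset.sum_congr rfl fun σ _ => ?_
    rw [← Finset.sum_neg_distrib]
    refine Finset.sum_congr rfl fun ε _ => ?_
    simp [hc, Equiv.Perm.sign_mul, Equiv.Perm.sign_swap hij]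
  exact self_eq_neg.mp key

theorem DSum_flip (m : ℕ) (a : Fin m → ℂ) (c : Fin m → ℤ) (δ : Fin m → ℤˣ)
    (hδ : ∏ i, δ i = 1) : DSum m a (fun k => (δ k : ℤ) * c k) = DSum m a c := by
  unfold DSum
  refine Finset.sum_congr rfl fun σ _ => ?_
  have hσ : ∏ i, δ (σ i) = 1 := by rw [Equiv.prod_comp σ δ, hδ]
  refine Finset.sum_bij' (fun ε _ => fun i => ε i * δ (σ i)) (fun ε _ => fun i => ε i * δ (σ i))
    ?_ ?_ ?_ ?_ ?_
  · intro ε hε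
    simp only [Finset.mem_filter, Finset.mem_univ, true_and] at hε ⊢
    rw [Finset.prod_mul_distrib, hε, hσ, mul_one]
  · intro ε hε
    simp only [Finset.mem_filter, Finset.mem_univ, true_and] at hε ⊢
    rw [Finset.prod_mul_distrib, hε, hσ, mul_one]
  · intro ε _
    funext i
    simp [mul_assoc]
  · intro ε _
    funext i
    simp [mul_assoc]
  · intro ε _
    simp [mul_assoc]

theorem DSum_cvecP_neg (m : ℕ) (hm : 2 ≤ m) (a : Fin m → ℂ) (p : ℤ) :
    DSum m a (cvecP m (-p)) = DSum m a (cvecP m p) := by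
  have h0 : 0 < m := by omega
  have h1 : m - 1 < m := by omega
  rw [← DSum_flip m a (cvecP m p)
    (Pi.mulSingle (⟨0, h0⟩ : Fin m) (-1) * Pi.mulSingle (⟨m - 1, h1⟩ : Fin m) (-1))]
  · congr 1
    funext k
    simp only [cvecP, Pi.mul_apply, Pi.mulSingle_apply, Fin.ext_iff]
    by_cases hk : (k : ℕ) = 0
    · have h2 : ¬ (0 = m - 1) := by omega
      simp [hk, h2]
    · by_cases hk' : (k : ℕ) = m - 1
      · have : (m : ℤ) - 1 - (k : ℕ) = 0 := by omega
        simp only [hk, if_false, this, mul_zero]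
      · simp [hk, hk']
  · simp [Finset.prod_mul_distrib]

theorem DSum_cvecP_zero (m : ℕ) (a : Fin m → ℂ) (p : ℤ) (hp : 0 ≤ p)
    (hp' : p ≤ (m : ℤ) - 2) : DSum m a (cvecP m p) = 0 := by
  refine DSum_eq_zero m a _ ⟨0, by omega⟩ ⟨m - 1 - p.toNat, by omega⟩ ?_ ?_
  · simp only [ne_eq, Fin.mk.injEq]; omega
  · simp only [cvecP]
    have : ¬ (m - 1 - p.toNat = 0) := by omega
    simp only [this, if_true, if_false]
    omega

theorem cvecP_rho (m : ℕ) : cvecP m ((m : ℤ) - 1) = rhoD m := by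
  funext k
  simp only [cvecP, rhoD]
  split_ifs with h <;> omega

/-- if `a_i^{n+2m−1} = 1` for all `i`, then (in Weyl-numerator form, meaning
`Q¹_{n+1} = 1`, `Q¹_{n+j} = 0` for `j = 2, …, 2m−2`, and `Q¹_{n+2m−1} = 1`):
(i) `S(c(n+m)) = S(ρ)`; (ii) `S(c(n+m+j−1)) = 0` for `2 ≤ j ≤ m−1`;
(iii) `S(c(n+2m−1)) = 0`; (iv) `S(c(n+3m−j−1)) = 0` for `2 ≤ j ≤ m−1`;
(v) `S(c(n+3m−2)) = S(ρ)`. -/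
theorem stmt8 (m n : ℕ) (hm : 2 ≤ m) (hn : 1 ≤ n) (a : Fin m → ℂ)
    (ha : ∀ i, a i ≠ 0) (haN : ∀ i, a i ^ (n + 2 * m - 1) = 1) :
    DSum m a (cvecP m ((n : ℤ) + m)) = DSum m a (rhoD m) ∧
    (∀ j : ℤ, 2 ≤ j → j ≤ (m : ℤ) - 1 →
      DSum m a (cvecP m ((n : ℤ) + m + j - 1)) = 0) ∧
    DSum m a (cvecP m ((n : ℤ) + 2 * m - 1)) = 0 ∧
    (∀ j : ℤ, 2 ≤ j → j ≤ (m : ℤ) - 1 →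
      DSum m a (cvecP m ((n : ℤ) + 3 * m - j - 1)) = 0) ∧
    DSum m a (cvecP m ((n : ℤ) + 3 * m - 2)) = DSum m a (rhoD m) := by
  have red : ∀ p q : ℤ, p = q + ((n : ℤ) + 2 * m - 1) →
      DSum m a (cvecP m p) = DSum m a (cvecP m q) := by
    intro p q hpq
    refine DSum_congr_mod m (n + 2 * m - 1) a ha haN _ _ fun k => ?_
    by_cases hk : (k : ℕ) = 0
    · refine ⟨1, ?_⟩
      simp only [cvecP, hk, if_true]
      omega
    · exact ⟨0, by simp [cvecP, hk]⟩
  refine ⟨?_, ?_, ?_, ?_, ?_⟩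
  · rw [red _ (-((m : ℤ) - 1)) (by ring), DSum_cvecP_neg m hm, cvecP_rho]
  · intro j h2 hj
    rw [red _ (-((m : ℤ) - j)) (by ring), DSum_cvecP_neg m hm]
    exact DSum_cvecP_zero m a _ (by omega) (by omega)
  · rw [red _ 0 (by ring)]
    exact DSum_cvecP_zero m a _ (by omega) (by omega)
  · intro j h2 hj
    rw [red _ ((m : ℤ) - j) (by ring)]
    exact DSum_cvecP_zero m a _ (by omega) (by omega)
  · rw [red _ ((m : ℤ) - 1) (by ring), cvecP_rho]
end

section
/- Let r ≥ 1 and let b_1, …, b_r be nonzero complex numbers. Let P_+ = Σ_{ε∈{±1}^r, ε_1⋯ε_r = +1} ∏_{i=1}^r b_i^{ε_i} and P_− = Σ_{ε∈{±1}^r, ε_1⋯ε_r = −1} ∏_{i=1}^r b_i^{ε_i}, and let e_k denote the k-th elementary symmetric polynomial evaluated at the 2r numbers b_1², b_1^{−2}, …, b_r², b_r^{−2} (with e_0 = 1). Then P_+² + P_−² = e_r + 2(e_{r−2} + e_{r−4} + ⋯), where the sum extends over all nonnegative indices r−2k ≥ 0 with k ≥ 1. (This expresses the sum of squares of the two half-spinor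 characters of D_r as χ(ω_{r−1})² + χ(ω_r)² = Σ a_{i_1}⋯a_{i_r} + 2Q₁^{r−2}, with a_i = b_i².) -/
/-- The half-spinor sum `P_s = Σ_{ε∈{±1}^r, ε_1⋯ε_r = s} ∏ i, b i ^ ε i`. -/
noncomputable def Pspin (r : ℕ) (b : Fin r → ℂ) (s : ℤˣ) : ℂ :=
  ∑ ε ∈ Finset.univ.filter (fun ε : Fin r → ℤˣ => ∏ i, ε i = s),
    ∏ i, b i ^ (ε i : ℤ)

/-- The `k`-th elementary symmetric polynomial evaluated at the `2r` numbers
`b_1², b_1^{−2}, …, b_r², b_r^{−2}` (indexed by `Fin r × Bool`). -/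
noncomputable def esymm2r (r : ℕ) (b : Fin r → ℂ) (k : ℕ) : ℂ :=
  ∑ t ∈ (Finset.univ : Finset (Fin r × Bool)).powersetCard k,
    ∏ p ∈ t, if p.2 then b p.1 ^ (2 : ℤ) else b p.1 ^ (-2 : ℤ)

lemma Pspin_add (r : ℕ) (b : Fin r → ℂ) :
    Pspin r b 1 + Pspin r b (-1) = ∏ i, (b i + (b i)⁻¹) := by
  have h : ∏ i, (b i + (b i)⁻¹) = ∏ i, ∑ u : ℤˣ, b i ^ (u : ℤ) := by
    refine Finset.prod_congr rfl fun i _ => ?_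
    simp [UnitsInt.univ]
  rw [h, Finset.prod_univ_sum, Fintype.piFinset_univ]
  unfold Pspin
  rw [← Finset.sum_filter_add_sum_filter_not Finset.univ (fun ε : Fin r → ℤˣ => ∏ i, ε i = 1)]
  congr 1
  refine Finset.sum_congr ?_ fun _ _ => rfl
  ext ε
  rcases Int.units_eq_one_or (∏ i, ε i) with h | h <;> simp [h]

lemma Pspin_sub (r : ℕ) (b : Fin r → ℂ) :
    Pspin r b 1 - Pspin r b (-1) = ∏ i, (b i - (b i)⁻¹) := by
  have h : ∏ i, (b i - (b i)⁻¹) = ∏ i, ∑ u : ℤˣ, ((u : ℤ) : ℂ) * b i ^ (u : ℤ) := by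
    refine Finset.prod_congr rfl fun i _ => ?_
    simp [UnitsInt.univ, sub_eq_add_neg]
  rw [h, Finset.prod_univ_sum, Fintype.piFinset_univ]
  unfold Pspin
  rw [← Finset.sum_filter_add_sum_filter_not Finset.univ (fun ε : Fin r → ℤˣ => ∏ i, ε i = 1),
    sub_eq_add_neg, ← Finset.sum_neg_distrib]
  have key : ∀ ε : Fin r → ℤˣ, ∏ i, (((ε i : ℤ) : ℂ) * b i ^ (ε i : ℤ))
      = (((∏ i, ε i : ℤˣ) : ℤ) : ℂ) * ∏ i, b i ^ (ε i : ℤ) := by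
    intro ε
    rw [Finset.prod_mul_distrib]
    push_cast
    rfl
  congr 1
  · refine Finset.sum_congr rfl fun ε hε => ?_
    rw [key, (Finset.mem_filter.1 hε).2]; simp
  · refine Finset.sum_congr ?_ fun ε hε => ?_
    · ext ε
      rcases Int.units_eq_one_or (∏ i, ε i) with h | h <;> simp [h]
    · have h2 : ∏ i, ε i = -1 := by
        rcases Int.units_eq_one_or (∏ i, ε i) with h | h
        · simp [h] at hε
        · exact h
      rw [key, h2]; simp

lemma esymm2r_gen (r : ℕ) (b : Fin r → ℂ) (c : ℂ) :
    ∑ k ∈ Finset.range (2 * r + 1), c ^ k * esymm2r r b k =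
      ∏ i, ((1 + c * b i ^ (2 : ℤ)) * (1 + c * b i ^ (-2 : ℤ))) := by
  have h : ∏ i, ((1 + c * b i ^ (2 : ℤ)) * (1 + c * b i ^ (-2 : ℤ))) =
      ∏ p : Fin r × Bool, (1 + c * if p.2 then b p.1 ^ (2 : ℤ) else b p.1 ^ (-2 : ℤ)) := by
    rw [Fintype.prod_prod_type]
    refine Finset.prod_congr rfl fun i _ => ?_
    simp
  rw [h, Finset.prod_one_add, Finset.sum_powerset]
  have hc : (Finset.univ : Finset (Fin r × Bool)).card = 2 * r := by
    simp [mul_comm]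
  rw [hc]
  refine Finset.sum_congr rfl fun k _ => ?_
  unfold esymm2r
  rw [Finset.mul_sum]
  refine Finset.sum_congr rfl fun t ht => ?_
  rw [Finset.prod_mul_distrib, Finset.prod_const, (Finset.mem_powersetCard.1 ht).2]

def swapB (r : ℕ) : (Fin r × Bool) ≃ (Fin r × Bool) :=
  (Equiv.refl _).prodCongr Equiv.boolNot

lemma swapB_swapB (r : ℕ) (p : Fin r × Bool) : swapB r (swapB r p) = p := by
  rcases p with ⟨i, _ | _⟩ <;> rfl

lemma esymm2r_symm (r : ℕ) (b : Fin r → ℂ) (hb : ∀ i, b i ≠ 0) (k : ℕ) (hk : k ≤ 2 * r) :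
    esymm2r r b (2 * r - k) = esymm2r r b k := by
  have hc : Fintype.card (Fin r × Bool) = 2 * r := by
    simp [mul_comm]
  have inv : ∀ t : Finset (Fin r × Bool),
      ((((tᶜ).map (swapB r).toEmbedding)ᶜ).map (swapB r).toEmbedding) = t := by
    intro t
    ext p
    simp only [Finset.mem_map_equiv, Finset.mem_compl]
    have : (swapB r).symm ((swapB r).symm p) = p := by
      rw [Equiv.symm_apply_eq, Equiv.symm_apply_eq, swapB_swapB]
    simp [this]
  unfold esymm2r
  refine Finset.sum_nbij' (fun t => (tᶜ).map (swapB r).toEmbedding)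
    (fun t => (tᶜ).map (swapB r).toEmbedding) ?_ ?_ ?_ ?_ ?_
  · intro t ht
    rw [Finset.mem_powersetCard] at ht ⊢
    refine ⟨Finset.subset_univ _, ?_⟩
    rw [Finset.card_map, Finset.card_compl, hc, ht.2]; omega
  · intro t ht
    rw [Finset.mem_powersetCard] at ht ⊢
    refine ⟨Finset.subset_univ _, ?_⟩
    rw [Finset.card_map, Finset.card_compl, hc, ht.2]
  · intro t _; exact inv t
  · intro t _; exact inv t
  · intro t _
    rw [Finset.prod_map]
    set x : Fin r × Bool → ℂ := fun p => if p.2 then b p.1 ^ (2 : ℤ) else b p.1 ^ (-2 : ℤ) with hx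
    have hx0 : ∀ p, x p ≠ 0 := by
      intro p
      simp only [hx]
      split_ifs <;> exact zpow_ne_zero _ (hb _)
    have hs : ∀ p, x (swapB r p) = (x p)⁻¹ := by
      rintro ⟨i, _ | _⟩ <;> simp [hx, swapB]
    have htot : ∏ p, x p = 1 := by
      rw [Fintype.prod_prod_type]
      refine Finset.prod_eq_one fun i _ => ?_
      have := hb i
      simp [hx]
      field_simp
    change ∏ p ∈ t, x p = ∏ p ∈ tᶜ, x (swapB r p)
    simp only [hs, Finset.prod_inv_distrib]
    refine eq_inv_of_mul_eq_one_left ?_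
    rw [Finset.prod_mul_prod_compl, htot]

lemma sum_sym (r : ℕ) (f : ℕ → ℂ) (hf : ∀ k ≤ 2 * r, f (2 * r - k) = f k) :
    ∑ k ∈ Finset.range (2 * r + 1), f k = f r + 2 * ∑ k ∈ Finset.range r, f k := by
  have h1 : 2 * r + 1 = (r + 1) + r := by ring
  rw [h1, Finset.sum_range_add, Finset.sum_range_succ]
  have : ∑ x ∈ Finset.range r, f (r + 1 + x) = ∑ k ∈ Finset.range r, f k := by
    rw [← Finset.sum_range_reflect f r]
    refine Finset.sum_congr rfl fun x hx => ?_
    have := Finset.mem_range.1 hx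
    rw [← hf (r - 1 - x) (by omega)]
    congr 1; omega
  rw [this]; ring

lemma sum_par (r : ℕ) (f : ℕ → ℂ) :
    ∑ k ∈ Finset.range r, (1 + (-1) ^ (r + k)) * f k
      = 2 * ∑ k ∈ Finset.Icc 1 (r / 2), f (r - 2 * k) := by
  have : ∀ k ∈ Finset.range r, (1 + (-1) ^ (r + k)) * f k
      = if Even (r + k) then 2 * f k else 0 := by
    intro k _
    split_ifs with h
    · rw [h.neg_one_pow]; ring
    · rw [(Nat.not_even_iff_odd.1 h).neg_one_pow]; ring
  rw [Finset.sum_congr rfl this, ← Finset.sum_filter, Finset.mul_sum]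
  refine Finset.sum_nbij' (fun k => (r - k) / 2) (fun k => r - 2 * k) ?_ ?_ ?_ ?_ ?_
  · intro k hk
    simp only [Finset.mem_filter, Finset.mem_range, Finset.mem_Icc, Nat.even_iff] at *
    omega
  · intro k hk
    simp only [Finset.mem_filter, Finset.mem_range, Finset.mem_Icc, Nat.even_iff] at *
    omega
  · intro k hk
    simp only [Finset.mem_filter, Finset.mem_range, Nat.even_iff] at *
    omega
  · intro k hk
    simp only [Finset.mem_Icc] at *
    omega
  · intro k hk
    simp only [Finset.mem_filter, Finset.mem_range, Nat.even_iff] at hk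
    have : r - 2 * ((r - k) / 2) = k := by omega
    simp only [this]

/-- `P_+² + P_−² = e_r + 2(e_{r−2} + e_{r−4} + ⋯)` (sum over all
nonnegative indices `r−2k` with `k ≥ 1`). -/
theorem stmt13 (r : ℕ) (hr : 1 ≤ r) (b : Fin r → ℂ) (hb : ∀ i, b i ≠ 0) :
    Pspin r b 1 ^ 2 + Pspin r b (-1) ^ 2 =
      esymm2r r b r + 2 * ∑ k ∈ Finset.Icc 1 (r / 2), esymm2r r b (r - 2 * k) := by
  have hA : (Pspin r b 1 + Pspin r b (-1)) ^ 2 =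
      ∑ k ∈ Finset.range (2 * r + 1), esymm2r r b k := by
    have := esymm2r_gen r b 1
    simp only [one_pow, one_mul] at this
    rw [this, Pspin_add, ← Finset.prod_pow]
    refine Finset.prod_congr rfl fun i _ => ?_
    have := hb i
    rw [zpow_neg, zpow_ofNat]
    field_simp
    ring
  have hB : (Pspin r b 1 - Pspin r b (-1)) ^ 2 =
      ∑ k ∈ Finset.range (2 * r + 1), (-1) ^ (r + k) * esymm2r r b k := by
    have := esymm2r_gen r b (-1)
    simp only [pow_add, mul_assoc]
    rw [← Finset.mul_sum, this, Pspin_sub, ← Finset.prod_pow]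
    have h1 : (-1 : ℂ) ^ r = ∏ _i : Fin r, (-1 : ℂ) := by simp
    rw [h1, ← Finset.prod_mul_distrib]
    refine Finset.prod_congr rfl fun i _ => ?_
    have := hb i
    rw [zpow_neg, zpow_ofNat]
    field_simp
    ring
  have hC := sum_sym r (fun k => (1 + (-1) ^ (r + k)) * esymm2r r b k) (by
    intro k hk
    rw [esymm2r_symm r b hb k hk]
    congr 2
    rw [neg_one_pow_eq_pow_mod_two, neg_one_pow_eq_pow_mod_two (n := r + k)]
    congr 1
    omega)
  rw [sum_par] at hC
  simp only [add_mul, one_mul, Finset.sum_add_distrib] at hC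
  rw [← hA, ← hB, (Even.add_self r).neg_one_pow] at hC
  linear_combination hC / 2
end
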